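/- There is an absolute constant c > 0 such that the following holds. Let G be a triangle-free finite simple graph on n ≥ 1 vertices with maximum degree Δ ≥ 1, and let 0 < λ ≤ c/Δ⁴. For each vertex u, set g_u = λ/(1+λ) if d_u = 0, and g_u = (λ/(1+λ))·W(d_u·log(1+λ))/(d_u·log(1+λ)) if d_u ≥ 1. Then (1/n)·Σ_{u∈V(G)} g_u ≤ E_G(λ). -/

import Mathlib

open scoped Classical

/-- The finset of independent sets of a finite simple graph (the empty set counts). -/
noncomputable def indepSets {V : Type*} [Fintype V] (G : SimpleGraph V) : Finset (Finset V) :=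
  Finset.univ.filter fun I => ∀ u ∈ I, ∀ v ∈ I, ¬ G.Adj u v

/-- The hard-core partition function `Z_G(λ) = Σ_{I independent} λ^|I|`. -/
noncomputable def hcZ {V : Type*} [Fintype V] (G : SimpleGraph V) (l : ℝ) : ℝ :=
  ∑ I ∈ indepSets G, l ^ I.card

/-- The occupancy fraction `E_G(λ) = λ Z_G'(λ)/(n Z_G(λ))`, i.e. `(1/n)` times the
expected size of an independent set from the hard-core model; note
`λ Z_G'(λ) = Σ_I |I| λ^|I|`. -/
noncomputable def hcE {V : Type*} [Fintype V] (G : SimpleGraph V) (l : ℝ) : ℝ :=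
  (∑ I ∈ indepSets G, (I.card : ℝ) * l ^ I.card) / ((Fintype.card V : ℝ) * hcZ G l)

section HardCore

variable {V : Type*} [Fintype V]

/-- The expectation of `f` under the hard-core model on `G` at fugacity `l`. -/
noncomputable def hcExp (G : SimpleGraph V) (l : ℝ) (f : Finset V → ℝ) : ℝ :=
  (∑ I ∈ indepSets G, l ^ I.card * f I) / hcZ G l

variable {G : SimpleGraph V} {l : ℝ}

lemma hcZ_pos (hl : 0 < l) : 0 < hcZ G l := by
  refine Finset.sum_pos (fun I _ => by positivity) ⟨∅, ?_⟩
  simp [indepSets]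

lemma hcExp_one (hl : 0 < l) : hcExp G l (fun _ => 1) = 1 := by
  have h := (hcZ_pos (G := G) hl).ne'
  simp only [hcExp, mul_one]
  exact div_self h

lemma hcExp_mono (hl : 0 < l) {f g : Finset V → ℝ} (h : ∀ I, f I ≤ g I) :
    hcExp G l f ≤ hcExp G l g := by
  refine div_le_div_of_nonneg_right (Finset.sum_le_sum fun I _ => ?_) (hcZ_pos hl).le
  exact mul_le_mul_of_nonneg_left (h I) (by positivity)

lemma hcExp_add (f g : Finset V → ℝ) :
    hcExp G l (fun I => f I + g I) = hcExp G l f + hcExp G l g := by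
  simp only [hcExp, mul_add, Finset.sum_add_distrib, add_div]

lemma hcExp_sub (f g : Finset V → ℝ) :
    hcExp G l (fun I => f I - g I) = hcExp G l f - hcExp G l g := by
  simp only [hcExp, mul_sub, Finset.sum_sub_distrib, sub_div]

lemma hcExp_const_mul (c : ℝ) (f : Finset V → ℝ) :
    hcExp G l (fun I => c * f I) = c * hcExp G l f := by
  simp only [hcExp, mul_left_comm _ c, ← Finset.mul_sum, mul_div_assoc]

lemma hcExp_sum {ι : Type*} (s : Finset ι) (f : ι → Finset V → ℝ) :
    hcExp G l (fun I => ∑ i ∈ s, f i I) = ∑ i ∈ s, hcExp G l (f i) := by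
  simp only [hcExp, Finset.mul_sum, ← Finset.sum_div]
  rw [Finset.sum_comm]

lemma hcE_eq_hcExp :
    hcE G l = 1 / (Fintype.card V : ℝ) * hcExp G l (fun I => (I.card : ℝ)) := by
  simp only [hcE, hcExp, mul_comm (l ^ _)]
  rw [div_mul_div_comm, one_mul]

/-- The spatial Markov property at a vertex `v`, for observables that do not depend on `v`. -/
lemma hcExp_mem_mul (hl : 0 < l) (v : V) (f : Finset V → ℝ)
    (hf : ∀ I, v ∉ I → f (insert v I) = f I) :
    hcExp G l (fun I => if v ∈ I then f I else 0) =
      l / (1 + l) * hcExp G l (fun I => if Disjoint I (G.neighborFinset v) then f I else 0) := by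
  set A := (indepSets G).filter fun I => v ∈ I with hA
  set B := (indepSets G).filter fun I => Disjoint I (G.neighborFinset v) ∧ v ∉ I with hB
  have hAB : ∑ I ∈ A, l ^ I.card * f I = l * ∑ I ∈ B, l ^ I.card * f I := by
    rw [Finset.mul_sum]
    symm
    refine Finset.sum_bij' (fun I _ => insert v I) (fun I _ => I.erase v) ?_ ?_ ?_ ?_ ?_
    · intro I hI
      simp only [hB, hA, indepSets, Finset.mem_filter, Finset.mem_univ, true_and,
        Finset.disjoint_left, SimpleGraph.mem_neighborFinset, Finset.mem_insert, true_or,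
        and_true] at hI ⊢
      obtain ⟨h1, h2, h3⟩ := hI
      rintro a (rfl | ha) b (rfl | hb)
      · exact G.loopless.irrefl _
      · exact h2 hb
      · exact fun h => h2 ha h.symm
      · exact h1 a ha b hb
    · intro I hI
      simp only [hB, hA, indepSets, Finset.mem_filter, Finset.mem_univ, true_and,
        Finset.disjoint_left, SimpleGraph.mem_neighborFinset, Finset.mem_erase, ne_eq,
        not_true_eq_false, false_and, not_false_eq_true, and_true] at hI ⊢
      exact ⟨fun a ha b hb => hI.1 a ha.2 b hb.2, fun a ha => hI.1 v hI.2 a ha.2⟩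
    · intro I hI
      exact Finset.erase_insert (Finset.mem_filter.1 hI).2.2
    · intro I hI
      exact Finset.insert_erase (Finset.mem_filter.1 hI).2
    · intro I hI
      have h := (Finset.mem_filter.1 hI).2.2
      rw [Finset.card_insert_of_notMem h, hf I h]
      ring
  have h1 : ∑ I ∈ indepSets G, l ^ I.card * (if v ∈ I then f I else 0) =
      ∑ I ∈ A, l ^ I.card * f I := by
    simp only [hA, mul_ite, mul_zero, Finset.sum_filter]
  have h2 : ∑ I ∈ indepSets G, l ^ I.card *
      (if Disjoint I (G.neighborFinset v) then f I else 0) =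
      ∑ I ∈ A, l ^ I.card * f I + ∑ I ∈ B, l ^ I.card * f I := by
    simp only [hA, hB, mul_ite, mul_zero, Finset.sum_filter]
    rw [← Finset.sum_add_distrib]
    refine Finset.sum_congr rfl fun I hI => ?_
    by_cases hv : v ∈ I
    · have : Disjoint I (G.neighborFinset v) := by
        simp only [indepSets, Finset.mem_filter, Finset.mem_univ, true_and] at hI
        rw [Finset.disjoint_left]
        intro a ha
        rw [SimpleGraph.mem_neighborFinset]
        exact hI v hv a ha
      simp [hv, this]
    · simp [hv]
  rw [hcExp, hcExp, h1, h2, hAB]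
  have : 1 + l ≠ 0 := by positivity
  field_simp
  ring

/-- The probability that `v` lies in the random independent set. -/
noncomputable def hcMarginal (G : SimpleGraph V) (l : ℝ) (v : V) : ℝ :=
  hcExp G l fun I => if v ∈ I then 1 else 0

/-- The probability that no neighbour of `v` lies in the random independent set. -/
noncomputable def hcFree (G : SimpleGraph V) (l : ℝ) (v : V) : ℝ :=
  hcExp G l fun I => if Disjoint I (G.neighborFinset v) then 1 else 0

lemma hcMarginal_eq (hl : 0 < l) (v : V) :
    hcMarginal G l v = l / (1 + l) * hcFree G l v :=
  hcExp_mem_mul hl v (fun _ => 1) fun _ _ => rfl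

lemma hcExp_subset_le (hl : 0 < l) (S : Finset V) :
    hcExp G l (fun I => if S ⊆ I then 1 else 0) ≤ (l / (1 + l)) ^ S.card := by
  induction S using Finset.induction_on with
  | empty => simp [hcExp_one hl]
  | insert v S hv ih =>
    have h1 : (fun I : Finset V => if insert v S ⊆ I then (1 : ℝ) else 0) =
        fun I => if v ∈ I then (if S ⊆ I then 1 else 0) else 0 := by
      funext I
      simp only [Finset.insert_subset_iff, ite_and]
    rw [h1, hcExp_mem_mul hl v, Finset.card_insert_of_notMem hv, pow_succ']
    · refine mul_le_mul_of_nonneg_left (le_trans (hcExp_mono hl fun I => ?_) ih) (by positivity)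
      split_ifs <;> norm_num
    · intro I _
      simp only [Finset.subset_insert_iff_of_notMem hv]

lemma hcMarginal_le (hl : 0 < l) (v : V) : hcMarginal G l v ≤ l / (1 + l) := by
  simpa [hcMarginal] using hcExp_subset_le (G := G) hl {v}

lemma hcExp_choose_le (hl : 0 < l) (N : Finset V) (r : ℕ) :
    hcExp G l (fun I => ((I ∩ N).card.choose r : ℝ)) ≤
      (N.card.choose r : ℝ) * (l / (1 + l)) ^ r := by
  have h : (fun I : Finset V => ((I ∩ N).card.choose r : ℝ)) =
      fun I => ∑ S ∈ N.powersetCard r, if S ⊆ I then 1 else 0 := by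
    funext I
    rw [← Finset.card_powersetCard, Finset.sum_boole]
    congr 2
    ext S
    simp only [Finset.mem_powersetCard, Finset.mem_filter, Finset.subset_inter_iff]
    tauto
  rw [h, hcExp_sum, ← Finset.card_powersetCard, ← nsmul_eq_mul]
  refine Finset.sum_le_card_nsmul _ _ _ fun S hS => ?_
  rw [← (Finset.mem_powersetCard.1 hS).2]
  exact hcExp_subset_le hl S

lemma hcExp_card_inter (N : Finset V) :
    hcExp G l (fun I => ((I ∩ N).card : ℝ)) = ∑ v ∈ N, hcMarginal G l v := by
  have h : (fun I : Finset V => ((I ∩ N).card : ℝ)) =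
      fun I => ∑ v ∈ N, if v ∈ I then 1 else 0 := by
    funext I
    rw [Finset.sum_boole, Finset.inter_comm, Finset.filter_mem_eq_inter]
  rw [h, hcExp_sum]
  rfl

lemma hcExp_card_inter_le (hl : 0 < l) (N : Finset V) :
    hcExp G l (fun I => ((I ∩ N).card : ℝ)) ≤ N.card * (l / (1 + l)) := by
  rw [hcExp_card_inter, ← nsmul_eq_mul]
  exact Finset.sum_le_card_nsmul _ _ _ fun v _ => hcMarginal_le hl v

/-- The first Bonferroni inequality for the hard-core model. -/
lemma hcExp_disjoint_ge (hl : 0 < l) (N : Finset V) :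
    1 - N.card * (l / (1 + l)) ≤ hcExp G l (fun I => if Disjoint I N then 1 else 0) := by
  have h : hcExp G l (fun I => 1 - ((I ∩ N).card : ℝ)) ≤
      hcExp G l (fun I => if Disjoint I N then 1 else 0) := by
    refine hcExp_mono hl fun I => ?_
    by_cases hd : Disjoint I N
    · simp [hd]
    · have : 1 ≤ (I ∩ N).card :=
        Finset.card_pos.2 (Finset.not_disjoint_iff_nonempty_inter.1 hd)
      have : (1 : ℝ) ≤ ((I ∩ N).card : ℝ) := by exact_mod_cast this
      simp only [hd, if_false]
      linarith
  rw [hcExp_sub, hcExp_one hl] at h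
  linarith [hcExp_card_inter_le (G := G) hl N]

/-- The second Bonferroni inequality for the hard-core model. -/
lemma hcExp_disjoint_le (hl : 0 < l) (N : Finset V) :
    hcExp G l (fun I => if Disjoint I N then 1 else 0) ≤
      1 - ∑ v ∈ N, hcMarginal G l v + N.card.choose 2 * (l / (1 + l)) ^ 2 := by
  have h : hcExp G l (fun I => if Disjoint I N then 1 else 0) ≤
      hcExp G l (fun I => 1 - ((I ∩ N).card : ℝ) + ((I ∩ N).card.choose 2 : ℝ)) := by
    refine hcExp_mono hl fun I => ?_
    by_cases hd : Disjoint I N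
    · simp [hd, Finset.disjoint_iff_inter_eq_empty.1 hd]
    · obtain ⟨k, hk⟩ : ∃ k, (I ∩ N).card = k + 1 := Nat.exists_eq_succ_of_ne_zero
        (Finset.card_pos.2 (Finset.not_disjoint_iff_nonempty_inter.1 hd)).ne'
      simp only [hd, if_false, hk, Nat.choose_succ_succ k 1, Nat.choose_one_right]
      push_cast
      linarith [Nat.cast_nonneg (α := ℝ) (k.choose (Nat.succ 1))]
  rw [hcExp_add, hcExp_sub, hcExp_one hl, hcExp_card_inter] at h
  linarith [hcExp_choose_le (G := G) hl N 2]

/-- The third Bonferroni inequality for the hard-core model. -/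
lemma hcExp_disjoint_ge_third (hl : 0 < l) (N : Finset V) :
    1 - ∑ v ∈ N, hcMarginal G l v
      + (1 / 2) * ∑ v ∈ N, ∑ w ∈ N.erase v,
          hcExp G l (fun I => if v ∈ I then (if w ∈ I then 1 else 0) else 0)
      - N.card.choose 3 * (l / (1 + l)) ^ 3 ≤
      hcExp G l (fun I => if Disjoint I N then 1 else 0) := by
  have h : hcExp G l (fun I => 1 - ((I ∩ N).card : ℝ) + ((I ∩ N).card.choose 2 : ℝ)
        - ((I ∩ N).card.choose 3 : ℝ)) ≤
      hcExp G l (fun I => if Disjoint I N then 1 else 0) := by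
    refine hcExp_mono hl fun I => ?_
    by_cases hd : Disjoint I N
    · simp [hd, Finset.disjoint_iff_inter_eq_empty.1 hd]
    · obtain ⟨k, hk⟩ : ∃ k, (I ∩ N).card = k + 1 := Nat.exists_eq_succ_of_ne_zero
        (Finset.card_pos.2 (Finset.not_disjoint_iff_nonempty_inter.1 hd)).ne'
      simp only [hd, if_false, hk, Nat.choose_succ_succ k 1, Nat.choose_succ_succ k 2,
        Nat.choose_one_right]
      push_cast
      linarith [Nat.cast_nonneg (α := ℝ) (k.choose 3)]
  have hpair : hcExp G l (fun I => ((I ∩ N).card.choose 2 : ℝ)) =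
      (1 / 2) * ∑ v ∈ N, ∑ w ∈ N.erase v,
          hcExp G l (fun I => if v ∈ I then (if w ∈ I then 1 else 0) else 0) := by
    simp only [← hcExp_sum]
    rw [← hcExp_const_mul]
    congr 1
    funext I
    have hinner : ∀ v, (∑ w ∈ N.erase v, if v ∈ I then (if w ∈ I then (1 : ℝ) else 0) else 0) =
        if v ∈ I then (((N.erase v) ∩ I).card : ℝ) else 0 := by
      intro v
      split_ifs
      · rw [Finset.sum_boole, Finset.filter_mem_eq_inter]
      · simp
    simp only [hinner]
    rw [← Finset.sum_filter, Finset.filter_mem_eq_inter, Finset.inter_comm I N]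
    have hconst : ∀ v ∈ N ∩ I, (((N.erase v) ∩ I).card : ℝ) = ((N ∩ I).card : ℝ) - 1 := by
      intro v hv
      rw [Finset.erase_inter, Finset.cast_card_erase_of_mem hv]
    rw [Finset.sum_congr rfl hconst, Finset.sum_const, nsmul_eq_mul, Nat.cast_choose_two]
    ring
  rw [hcExp_sub, hcExp_add, hcExp_sub, hcExp_one hl, hcExp_card_inter, hpair] at h
  linarith [hcExp_choose_le (G := G) hl N 3]

lemma hcExp_pair_ge (hl : 0 < l) {v w : V} (hvw : v ≠ w) (hadj : ¬ G.Adj v w) :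
    (l / (1 + l)) ^ 2 * (1 - (G.degree v + G.degree w) * (l / (1 + l))) ≤
      hcExp G l (fun I => if v ∈ I then (if w ∈ I then 1 else 0) else 0) := by
  have hw : w ∉ G.neighborFinset v := by simpa using hadj
  rw [hcExp_mem_mul hl v (fun I => if w ∈ I then 1 else 0)
    (fun I _ => by simp [Finset.mem_insert, hvw.symm])]
  have hswap : (fun I : Finset V => if Disjoint I (G.neighborFinset v) then
        (if w ∈ I then (1 : ℝ) else 0) else 0) =
      fun I => if w ∈ I then (if Disjoint I (G.neighborFinset v) then 1 else 0) else 0 := by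
    funext I
    split_ifs <;> rfl
  rw [hswap, hcExp_mem_mul hl w (fun I => if Disjoint I (G.neighborFinset v) then 1 else 0)
    (fun I _ => by simp only [Finset.disjoint_insert_left, hw, not_false_eq_true, true_and])]
  have hunion : (fun I : Finset V => if Disjoint I (G.neighborFinset w) then
        (if Disjoint I (G.neighborFinset v) then (1 : ℝ) else 0) else 0) =
      fun I => if Disjoint I (G.neighborFinset v ∪ G.neighborFinset w) then 1 else 0 := by
    funext I
    simp only [Finset.disjoint_union_right]
    split_ifs <;> simp_all
  rw [hunion, ← mul_assoc, ← sq]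
  refine mul_le_mul_of_nonneg_left (le_trans ?_ (hcExp_disjoint_ge hl _)) (by positivity)
  have hcard : ((G.neighborFinset v ∪ G.neighborFinset w).card : ℝ) ≤
      G.degree v + G.degree w := by
    exact_mod_cast Finset.card_union_le _ _
  have := mul_le_mul_of_nonneg_right hcard (show 0 ≤ l / (1 + l) by positivity)
  linarith

lemma hcMarginal_ge (hl : 0 < l) (v : V) :
    l / (1 + l) * (1 - G.degree v * (l / (1 + l))) ≤ hcMarginal G l v := by
  rw [hcMarginal_eq hl]
  exact mul_le_mul_of_nonneg_left (hcExp_disjoint_ge hl _) (by positivity)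

lemma hcFree_le (hl : 0 < l) (v : V) :
    hcFree G l v ≤ 1 - l / (1 + l) * G.degree v + (l / (1 + l)) ^ 2 *
      (∑ w ∈ G.neighborFinset v, (G.degree w : ℝ) + G.degree v * (G.degree v - 1) / 2) := by
  have h := hcExp_disjoint_le (G := G) hl (G.neighborFinset v)
  have h2 := Finset.sum_le_sum fun w (_ : w ∈ G.neighborFinset v) => hcMarginal_ge (G := G) hl w
  simp only [mul_sub, mul_one, Finset.sum_sub_distrib, Finset.sum_const, nsmul_eq_mul,
    SimpleGraph.card_neighborFinset_eq_degree] at h2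
  rw [SimpleGraph.card_neighborFinset_eq_degree, Nat.cast_choose_two] at h
  rw [← Finset.mul_sum, ← Finset.sum_mul] at h2
  unfold hcFree
  linarith

lemma hcFree_ge (hl : 0 < l) (hG : G.CliqueFree 3) (u : V) :
    1 - l / (1 + l) * G.degree u
      + (l / (1 + l)) ^ 2 *
        (∑ v ∈ G.neighborFinset u, (G.degree v : ℝ) + G.degree u * (G.degree u - 1) / 2)
      - (l / (1 + l)) ^ 3 *
        (∑ v ∈ G.neighborFinset u, (∑ w ∈ G.neighborFinset v, (G.degree w : ℝ)
            + G.degree v * (G.degree v - 1) / 2)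
          + (G.degree u - 1) * ∑ v ∈ G.neighborFinset u, (G.degree v : ℝ)
          + (G.degree u : ℝ) ^ 3 / 6) ≤ hcFree G l u := by
  set t := l / (1 + l) with ht
  have ht0 : 0 < t := by positivity
  set N := G.neighborFinset u with hN
  have hNc : N.card = G.degree u := G.card_neighborFinset_eq_degree u
  have h := hcExp_disjoint_ge_third (G := G) hl N
  have h1 : ∑ v ∈ N, hcMarginal G l v ≤ ∑ v ∈ N, t * (1 - t * G.degree v + t ^ 2 *
      (∑ w ∈ G.neighborFinset v, (G.degree w : ℝ) + G.degree v * (G.degree v - 1) / 2)) := by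
    refine Finset.sum_le_sum fun v _ => ?_
    rw [hcMarginal_eq hl]
    exact mul_le_mul_of_nonneg_left (hcFree_le hl v) ht0.le
  have h2 : ∑ v ∈ N, ∑ w ∈ N.erase v, t ^ 2 * (1 - (G.degree v + G.degree w) * t) ≤
      ∑ v ∈ N, ∑ w ∈ N.erase v,
        hcExp G l (fun I => if v ∈ I then (if w ∈ I then 1 else 0) else 0) := by
    refine Finset.sum_le_sum fun v hv => Finset.sum_le_sum fun w hw => ?_
    refine hcExp_pair_ge hl (Finset.ne_of_mem_erase hw).symm fun hadj => ?_
    refine hG {u, v, w} (SimpleGraph.is3Clique_triple_iff.2 ⟨?_, ?_, hadj⟩)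
    · simpa [hN] using hv
    · simpa [hN] using Finset.mem_of_mem_erase hw
  have h3 : ((N.card.choose 3 : ℕ) : ℝ) * t ^ 3 ≤ (G.degree u : ℝ) ^ 3 / 6 * t ^ 3 := by
    refine mul_le_mul_of_nonneg_right ?_ (by positivity)
    have := Nat.choose_le_pow_div (α := ℝ) 3 N.card
    rw [hNc] at this ⊢
    simpa [Nat.factorial] using this
  have h4 : ∑ v ∈ N, ∑ w ∈ N.erase v, t ^ 2 * (1 - ((G.degree v : ℝ) + G.degree w) * t) =
      t ^ 2 * (G.degree u * (G.degree u - 1)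
        - 2 * t * ((G.degree u - 1) * ∑ v ∈ N, (G.degree v : ℝ))) := by
    have : ∀ v ∈ N, ∑ w ∈ N.erase v, t ^ 2 * (1 - ((G.degree v : ℝ) + G.degree w) * t) =
        t ^ 2 * (G.degree u - 1 - G.degree v * t * G.degree u
          - t * ∑ w ∈ N, (G.degree w : ℝ) + 2 * t * G.degree v) := by
      intro v hv
      rw [Finset.sum_erase_eq_sub hv, ← Finset.mul_sum, Finset.sum_sub_distrib,
        ← Finset.sum_mul, Finset.sum_add_distrib]
      simp only [Finset.sum_const, nsmul_eq_mul, hNc]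
      ring
    rw [Finset.sum_congr rfl this, ← Finset.mul_sum]
    simp only [Finset.sum_add_distrib, Finset.sum_sub_distrib, ← Finset.mul_sum,
      ← Finset.sum_mul, Finset.sum_const, nsmul_eq_mul, hNc]
    ring
  have h5 : ∑ v ∈ N, t * (1 - t * G.degree v + t ^ 2 *
      (∑ w ∈ G.neighborFinset v, (G.degree w : ℝ) + G.degree v * (G.degree v - 1) / 2)) =
      t * (G.degree u - t * ∑ v ∈ N, (G.degree v : ℝ) + t ^ 2 *
        ∑ v ∈ N, (∑ w ∈ G.neighborFinset v, (G.degree w : ℝ)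
          + G.degree v * (G.degree v - 1) / 2)) := by
    rw [← Finset.mul_sum, Finset.sum_add_distrib, Finset.sum_sub_distrib, ← Finset.mul_sum,
      ← Finset.mul_sum]
    simp only [Finset.sum_const, nsmul_eq_mul, hNc, mul_one]
  rw [h4] at h2
  rw [h5] at h1
  unfold hcFree
  linarith

lemma sum_sum_neighborFinset (f : V → ℝ) :
    ∑ u, ∑ v ∈ G.neighborFinset u, f v = ∑ v, (G.degree v : ℝ) * f v := by
  rw [Finset.sum_comm' (t' := Finset.univ) (s' := fun v => G.neighborFinset v)]
  · simp
  · simp [G.adj_comm]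

lemma sum_degree_mul_sum_degree_le :
    ∑ u, (G.degree u : ℝ) * ∑ v ∈ G.neighborFinset u, (G.degree v : ℝ) ≤
      ∑ u, (G.degree u : ℝ) ^ 3 := by
  have h : ∀ u, (G.degree u : ℝ) * ∑ v ∈ G.neighborFinset u, (G.degree v : ℝ) ≤
      (G.degree u : ℝ) ^ 3 / 2 + ∑ v ∈ G.neighborFinset u, (G.degree v : ℝ) ^ 2 / 2 := by
    intro u
    have : (G.degree u : ℝ) ^ 3 / 2 =
        ∑ v ∈ G.neighborFinset u, (G.degree u : ℝ) ^ 2 / 2 := by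
      rw [Finset.sum_const, nsmul_eq_mul, SimpleGraph.card_neighborFinset_eq_degree]
      ring
    rw [this, ← Finset.sum_add_distrib, Finset.mul_sum]
    exact Finset.sum_le_sum fun v _ => by
      nlinarith [sq_nonneg ((G.degree u : ℝ) - G.degree v)]
  refine (Finset.sum_le_sum fun u _ => h u).trans_eq ?_
  rw [Finset.sum_add_distrib, sum_sum_neighborFinset, ← Finset.sum_add_distrib]
  exact Finset.sum_congr rfl fun u _ => by ring

/-- A lower bound for the expected size of a hard-core independent set in a triangle-free graph,
as a sum of local terms depending only on the degrees. -/
lemma sum_le_hcExp_card (hl : 0 < l) (hG : G.CliqueFree 3) :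
    ∑ u, l / (1 + l) * (1 - l / (1 + l) * G.degree u
      + (l / (1 + l)) ^ 2 * (3 / 2 * (G.degree u : ℝ) ^ 2 - G.degree u / 2)
      - (l / (1 + l)) ^ 3 * (8 / 3 * (G.degree u : ℝ) ^ 3 - 3 / 2 * (G.degree u : ℝ) ^ 2)) ≤
      hcExp G l (fun I => (I.card : ℝ)) := by
  have hcard : hcExp G l (fun I => (I.card : ℝ)) = ∑ u, l / (1 + l) * hcFree G l u := by
    have := hcExp_card_inter (G := G) (l := l) Finset.univ
    simp only [Finset.inter_univ] at this
    rw [this]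
    exact Finset.sum_congr rfl fun u _ => hcMarginal_eq hl u
  rw [hcard, ← Finset.mul_sum, ← Finset.mul_sum]
  refine mul_le_mul_of_nonneg_left ?_ (by positivity)
  refine le_trans ?_ (Finset.sum_le_sum fun u _ => hcFree_ge hl hG u)
  set t := l / (1 + l) with ht
  have ht0 : 0 < t := by positivity
  have hT := mul_le_mul_of_nonneg_left (sum_degree_mul_sum_degree_le (G := G))
    (show 0 ≤ 2 * t ^ 3 by positivity)
  set D : V → ℝ := fun u => ∑ v ∈ G.neighborFinset u, (G.degree v : ℝ) with hD
  have e1 : ∑ u, D u = ∑ u, (G.degree u : ℝ) ^ 2 := by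
    rw [hD, sum_sum_neighborFinset]
    exact Finset.sum_congr rfl fun u _ => by ring
  have e2 : ∑ u, ∑ v ∈ G.neighborFinset u, (D v + G.degree v * (G.degree v - 1) / 2) =
      ∑ u, (G.degree u : ℝ) * (D u + G.degree u * (G.degree u - 1) / 2) :=
    sum_sum_neighborFinset _
  have key : ∑ u, (1 - t * G.degree u
      + t ^ 2 * (D u + G.degree u * (G.degree u - 1) / 2)
      - t ^ 3 * (∑ v ∈ G.neighborFinset u, (D v + G.degree v * (G.degree v - 1) / 2)
          + (G.degree u - 1) * D u + (G.degree u : ℝ) ^ 3 / 6))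
      - ∑ u, (1 - t * G.degree u
        + t ^ 2 * (3 / 2 * (G.degree u : ℝ) ^ 2 - G.degree u / 2)
        - t ^ 3 * (8 / 3 * (G.degree u : ℝ) ^ 3 - 3 / 2 * (G.degree u : ℝ) ^ 2)) =
      (t ^ 2 + t ^ 3) * (∑ u, D u - ∑ u, (G.degree u : ℝ) ^ 2)
      - t ^ 3 * (∑ u, ∑ v ∈ G.neighborFinset u, (D v + G.degree v * (G.degree v - 1) / 2)
        - ∑ u, (G.degree u : ℝ) * (D u + G.degree u * (G.degree u - 1) / 2))
      + (2 * t ^ 3 * ∑ u, (G.degree u : ℝ) ^ 3 - 2 * t ^ 3 * ∑ u, (G.degree u : ℝ) * D u) := by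
    simp only [← Finset.sum_sub_distrib, ← Finset.sum_add_distrib, Finset.mul_sum]
    refine Finset.sum_congr rfl fun u _ => ?_
    ring
  rw [e1, e2] at key
  linarith [key]

end HardCore

/-- If `h * exp (x₀ * h) ≥ 1`, then `h` is an upper bound for `W x / x` whenever `x ≥ x₀`. -/
lemma div_le_of_mul_exp_eq {w x x₀ h : ℝ} (hx : 0 < x) (hxx : x₀ ≤ x)
    (hw : w * Real.exp w = x) (hh : 0 < h) (h1 : 1 ≤ h * Real.exp (x₀ * h)) : w / x ≤ h := by
  rw [div_le_iff₀ hx]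
  by_contra! hlt
  have hpos : 0 < h * x := mul_pos hh hx
  have h2 : 1 ≤ h * Real.exp (h * x) := by
    refine h1.trans (mul_le_mul_of_nonneg_left (Real.exp_le_exp.2 ?_) hh.le)
    nlinarith
  have h3 : h * x * Real.exp (h * x) < w * Real.exp w :=
    mul_lt_mul hlt (Real.exp_le_exp.2 hlt.le) (Real.exp_pos _) (hpos.trans hlt).le
  nlinarith

/-- The degree-three Taylor polynomial `P` of `W x / x` plus `10 * x ^ 4` satisfies
`P * exp (x * P) ≥ 1` for small `x ≥ 0`. -/
lemma one_le_taylor_mul_exp {x : ℝ} (hx : 0 ≤ x) (hx1 : x ≤ 1 / 100) :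
    1 / 2 ≤ 1 - x + 3 / 2 * x ^ 2 - 8 / 3 * x ^ 3 + 10 * x ^ 4 ∧
    1 ≤ (1 - x + 3 / 2 * x ^ 2 - 8 / 3 * x ^ 3 + 10 * x ^ 4) *
      Real.exp (x * (1 - x + 3 / 2 * x ^ 2 - 8 / 3 * x ^ 3 + 10 * x ^ 4)) := by
  have hx2 : x ^ 2 ≤ x / 100 := by nlinarith
  have hx3 : x ^ 3 ≤ x ^ 2 / 100 := by nlinarith [sq_nonneg x]
  have hx4 : x ^ 4 ≤ x ^ 3 / 100 := by nlinarith [pow_nonneg hx 3]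
  have hx5 : x ^ 5 ≤ x ^ 4 / 100 := by nlinarith [pow_nonneg hx 4]
  have p3 := pow_nonneg hx 3
  have p4 := pow_nonneg hx 4
  have p5 := pow_nonneg hx 5
  have p6 := pow_nonneg hx 6
  have hP0 : 1 / 2 ≤ 1 - x + 3 / 2 * x ^ 2 - 8 / 3 * x ^ 3 + 10 * x ^ 4 := by linarith
  refine ⟨hP0, ?_⟩
  generalize hP : 1 - x + 3 / 2 * x ^ 2 - 8 / 3 * x ^ 3 + 10 * x ^ 4 = P at hP0 ⊢
  have hq : 1 - x + 3 / 2 * x ^ 2 - 8 / 3 * x ^ 3 ≤ P := by linarith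
  have hq0 : 0 ≤ 1 - x + 3 / 2 * x ^ 2 - 8 / 3 * x ^ 3 := by linarith
  have hP2 : 1 - 2 * x + 4 * x ^ 2 - 25 / 3 * x ^ 3 ≤ P ^ 2 := by
    refine le_trans ?_ (pow_le_pow_left₀ hq0 hq 2)
    ring_nf
    linarith
  have hP3 : 1 - 3 * x + 15 / 2 * x ^ 2 - 20 * x ^ 3 ≤ P ^ 3 := by
    have h := mul_le_mul hq hP2 (by linarith) (by linarith)
    rw [pow_succ' P 2]
    refine le_trans ?_ h
    ring_nf
    linarith
  have hP4 : 1 - 4 * x ≤ P ^ 4 := by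
    have h : 1 - 2 * x ≤ P ^ 2 := by linarith
    have h2 := pow_le_pow_left₀ (by linarith) h 2
    have e : (P ^ 2) ^ 2 = P ^ 4 := by ring
    rw [e] at h2
    refine le_trans ?_ h2
    ring_nf
    linarith [sq_nonneg x]
  have hexp : 1 + x * P + (x * P) ^ 2 / 2 + (x * P) ^ 3 / 6 ≤ Real.exp (x * P) := by
    have h := Real.sum_le_exp_of_nonneg (x := x * P) (by positivity) 4
    simpa [Finset.sum_range_succ, Nat.factorial] using h
  refine le_trans ?_ (mul_le_mul_of_nonneg_left hexp (by linarith))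
  have e1 := mul_le_mul_of_nonneg_left hP2 hx
  have e2 := mul_le_mul_of_nonneg_left hP3 (pow_nonneg hx 2)
  have e3 := mul_le_mul_of_nonneg_left hP4 p3
  have e4 : P * (1 + x * P + (x * P) ^ 2 / 2 + (x * P) ^ 3 / 6) =
      P + x * P ^ 2 + x ^ 2 * P ^ 3 / 2 + x ^ 3 * P ^ 4 / 6 := by ring
  rw [e4]
  linarith

lemma taylor_le_log_one_add {l : ℝ} (hl : 0 < l) :
    l / (1 + l) + (l / (1 + l)) ^ 2 / 2 + (l / (1 + l)) ^ 3 / 3 ≤ Real.log (1 + l) := by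
  have hl1 : 0 < 1 + l := by positivity
  have h1 : 1 - l / (1 + l) = (1 + l)⁻¹ := by field_simp; ring
  have h2 : |l / (1 + l)| < 1 := by
    rw [abs_of_pos (by positivity), div_lt_one hl1]
    linarith
  have h := sum_le_hasSum (Finset.range 3)
    (fun n _ => by positivity) (Real.hasSum_pow_div_log_of_abs_lt_one h2)
  rw [h1, Real.log_inv, neg_neg] at h
  norm_num [Finset.sum_range_succ] at h
  linarith

lemma taylor_le_of_small {t d : ℝ} (ht : 0 < t) (hd : 1 ≤ d) (h : t * d ^ 4 ≤ 1 / 1000) :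
    let x := d * (t + t ^ 2 / 2 + t ^ 3 / 3)
    x ≤ 1 / 100 ∧
    1 - x + 3 / 2 * x ^ 2 - 8 / 3 * x ^ 3 + 10 * x ^ 4 ≤
      1 - t * d + t ^ 2 * (3 / 2 * d ^ 2 - d / 2) - t ^ 3 * (8 / 3 * d ^ 3 - 3 / 2 * d ^ 2) := by
  intro x
  have hd0 : 0 < d := by linarith
  have ht1 : t ≤ 1 / 1000 := le_trans (by nlinarith [one_le_pow₀ hd (n := 4)]) h
  have htd : t * d ≤ 1 / 1000 :=
    le_trans (mul_le_mul_of_nonneg_left (le_self_pow₀ hd (by norm_num)) ht.le) h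
  have htd2 : t * d ^ 2 ≤ 1 / 1000 :=
    le_trans (mul_le_mul_of_nonneg_left (pow_le_pow_right₀ hd (by norm_num)) ht.le) h
  set s := t + t ^ 2 / 2 + t ^ 3 / 3 with hs
  have ht2 : t ^ 2 ≤ t / 1000 := by nlinarith
  have ht3 : t ^ 3 ≤ t ^ 2 / 1000 := by nlinarith [sq_nonneg t]
  have ht5 : t ^ 5 ≤ t ^ 4 / 1000 := by nlinarith [pow_pos ht 4]
  have ht6 : t ^ 6 ≤ t ^ 5 / 1000 := by nlinarith [pow_pos ht 5]
  have hst : t ≤ s := by rw [hs]; linarith [pow_pos ht 2, pow_pos ht 3]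
  have hs2t : s ≤ 2 * t := by linarith
  have hs2 : s ^ 2 ≤ t ^ 2 + t ^ 3 + 2 * t ^ 4 := by
    have e : s ^ 2 = t ^ 2 + t ^ 3 + 11 / 12 * t ^ 4 + t ^ 5 / 3 + t ^ 6 / 9 := by rw [hs]; ring
    rw [e]
    linarith [pow_pos ht 4]
  have hs3 : t ^ 3 ≤ s ^ 3 := pow_le_pow_left₀ ht.le hst 3
  have hs4 : s ^ 4 ≤ 16 * t ^ 4 :=
    (pow_le_pow_left₀ (ht.le.trans hst) hs2t 4).trans_eq (by ring)
  refine ⟨?_, ?_⟩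
  · have := mul_le_mul_of_nonneg_left hs2t hd0.le
    change d * s ≤ _
    linarith
  · change 1 - d * s + 3 / 2 * (d * s) ^ 2 - 8 / 3 * (d * s) ^ 3 + 10 * (d * s) ^ 4 ≤ _
    have e2 := mul_le_mul_of_nonneg_left hs2 (pow_pos hd0 2).le
    have e3 := mul_le_mul_of_nonneg_left hs3 (pow_pos hd0 3).le
    have e4 := mul_le_mul_of_nonneg_left hs4 (pow_pos hd0 4).le
    have e5 : 0 ≤ t ^ 3 * (d / 3 - 3 * (t * d ^ 2) - 160 * (t * d ^ 4)) :=
      mul_nonneg (pow_pos ht 3).le (by linarith)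
    have e6 : d * s = d * t + d * t ^ 2 / 2 + d * t ^ 3 / 3 := by rw [hs]; ring
    simp only [mul_pow]
    rw [e6]
    linarith

/-- Theorem: there is an absolute constant `c > 0` such that for every triangle-free
graph `G` with maximum degree `Δ ≥ 1` and every `0 < λ ≤ c/Δ⁴`, the average over
vertices of `g_u` is at most the occupancy fraction, where `g_u` is defined via the
positive real branch `W` of the Lambert W-function. -/
theorem stmt1 (W : ℝ → ℝ)
    (hW : ∀ x : ℝ, 0 < x → 0 ≤ W x ∧ W x * Real.exp (W x) = x) :
    ∃ c : ℝ, 0 < c ∧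
      ∀ (V : Type) [Fintype V] (G : SimpleGraph V), G.CliqueFree 3 →
        1 ≤ Fintype.card V → 1 ≤ G.maxDegree →
        ∀ l : ℝ, 0 < l → l ≤ c / (G.maxDegree : ℝ) ^ 4 →
          (1 / (Fintype.card V : ℝ)) *
              ∑ u : V,
                (if G.degree u = 0 then l / (1 + l)
                 else (l / (1 + l)) * W ((G.degree u : ℝ) * Real.log (1 + l)) /
                    ((G.degree u : ℝ) * Real.log (1 + l)))
            ≤ hcE G l := by
  refine ⟨1 / 1000, by norm_num, fun V _ G hG _ hΔ l hl hlc => ?_⟩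
  rw [hcE_eq_hcExp]
  refine mul_le_mul_of_nonneg_left (le_trans ?_ (sum_le_hcExp_card hl hG)) (by positivity)
  refine Finset.sum_le_sum fun u _ => ?_
  have ht : 0 < l / (1 + l) := by positivity
  split_ifs with hu
  · simp [hu]
  rw [mul_div_assoc]
  refine mul_le_mul_of_nonneg_left ?_ ht.le
  have hd : (1 : ℝ) ≤ G.degree u := by exact_mod_cast Nat.one_le_iff_ne_zero.2 hu
  have hdΔ : (G.degree u : ℝ) ≤ G.maxDegree := by exact_mod_cast G.degree_le_maxDegree u
  have hΔ0 : (0 : ℝ) < G.maxDegree := by exact_mod_cast hΔ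
  have hsmall : l / (1 + l) * (G.degree u : ℝ) ^ 4 ≤ 1 / 1000 := by
    have h1 : l / (1 + l) ≤ l := div_le_self hl.le (by linarith)
    have h2 := pow_le_pow_left₀ (by positivity) hdΔ 4
    rw [le_div_iff₀ (by positivity)] at hlc
    exact (mul_le_mul h1 h2 (by positivity) hl.le).trans hlc
  have hlog := taylor_le_log_one_add hl
  obtain ⟨hx, hle⟩ := taylor_le_of_small ht hd hsmall
  obtain ⟨hP, hPexp⟩ := one_le_taylor_mul_exp (by positivity) hx
  have hL : 0 < (G.degree u : ℝ) * Real.log (1 + l) :=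
    mul_pos (by linarith) (Real.log_pos (by linarith))
  refine (div_le_of_mul_exp_eq hL (mul_le_mul_of_nonneg_left hlog (by positivity))
    (hW _ hL).2 (by linarith) hPexp).trans hle
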